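/- Let p > 3 be a prime and n = 2(p-1). For 0 ≤ s < (p-1)/2 the centralizer of E_{s,p-1-s} in Out(F_n) is isomorphic to Z/p × Aut(F_s) × Aut(F_{p-1-s}) (with Aut(F_0) the trivial group), while for s = (p-1)/2 the centralizer of E_{s,s} in Out(F_n) is isomorphic to Z/p × (Aut(F_s) ≀ Z/2). -/

import Mathlib

/-!
Formalization of statements from:
H. Glover, H.-W. Henn, "On the mod-p cohomology of Out(F_{2(p-1)})".
-/

noncomputable section
namespace OutFormal
open FreeGroup

/-! ### The outer automorphism group `Out G = Aut G / Inn G` -/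

variable (G : Type) [Group G]

instance conjRangeNormal : ((MulAut.conj : G →* MulAut G).range).Normal := by
  constructor
  rintro x ⟨g, rfl⟩ f
  refine ⟨f g, ?_⟩
  ext h
  simp only [MulAut.conj_apply, MulAut.mul_apply, MulAut.inv_def, _root_.map_mul,
    _root_.map_inv, MulEquiv.apply_symm_apply]

/-- `Out G = Aut G / Inn G`, the group of outer automorphisms of `G`. -/
def Out : Type := MulAut G ⧸ (MulAut.conj : G →* MulAut G).range

instance : Group (Out G) := QuotientGroup.Quotient.group _

/-- The class of an automorphism in `Out G`. -/
def Out.mk : MulAut G →* Out G := QuotientGroup.mk' _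

/-- `Out(F_n)` for `F_n` the free group on `n` generators. -/
abbrev OutF (n : ℕ) : Type := Out (FreeGroup (Fin n))

variable {G}

/-- The subgroups `H` and `K` of `G` are conjugate. -/
def SubConj (H K : Subgroup G) : Prop :=
  ∃ g : G, Subgroup.map (MulAut.conj g : G ≃* G).toMonoidHom H = K

/-- `H` is subconjugate to `K`, i.e. conjugate to a subgroup of `K`. -/
def SubConjLE (H K : Subgroup G) : Prop :=
  ∃ g : G, Subgroup.map (MulAut.conj g : G ≃* G).toMonoidHom H ≤ K

/-- An elementary abelian `p`-subgroup: an abelian subgroup of exponent dividing `p`. -/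
def IsElementaryAbelian (p : ℕ) (H : Subgroup G) : Prop :=
  (∀ a ∈ H, ∀ b ∈ H, a * b = b * a) ∧ ∀ a ∈ H, a ^ p = 1

/-- The set of outer classes of those automorphisms of the free group `F_n` which act on
the free basis, transported along the identification `eI : I ≃ Fin n`, by the
formula `rhs`.  (There is exactly one such automorphism.) -/
def formalGen {n : ℕ} {I : Type} (eI : I ≃ Fin n) (rhs : I → FreeGroup I) :
    Set (OutF n) :=
  {x | ∃ φ : MulAut (FreeGroup (Fin n)),
    (∀ k : I, φ (FreeGroup.of (eI k)) = FreeGroup.freeGroupCongr eI (rhs k)) ∧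
      x = Out.mk _ φ}

/-! ### The elementary abelian subgroups `E_R`, `E_{s,p-1-s}`, `E_2`, `Δ(E_2)` -/

/-- The effect, on the free basis `u_1, …, u_{p-1}` of the fundamental group of the graph
`Θ_{p-1}` (with `u_i = b_i b_0⁻¹` for the `p` edges `b_0, …, b_{p-1}`), of the graph
automorphism cyclically rotating the `p` edges. -/
def rotWord (p : ℕ) (hp : 0 < p - 1) (k : Fin (p - 1)) : FreeGroup (Fin (p - 1)) :=
  if h : (k : ℕ) + 1 < p - 1 then of ⟨(k : ℕ) + 1, h⟩ * (of ⟨0, hp⟩)⁻¹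
  else (of ⟨0, hp⟩)⁻¹

/-- Basis of `F_{2(p-1)}` adapted to the rose `R_{2(p-1)}`:
`p` petals `x_1, …, x_p` and `p-2` further petals `y_1, …, y_{p-2}`. -/
def eRose (p : ℕ) (h2 : 2 ≤ p) : Fin p ⊕ Fin (p - 2) ≃ Fin (2 * (p - 1)) :=
  finSumFinEquiv.trans (finCongr (by omega))

/-- The generator of `E_R`: it cyclically permutes the petals `x_1, …, x_p`
and fixes the petals `y_1, …, y_{p-2}`. -/
def rhsRose (p : ℕ) : Fin p ⊕ Fin (p - 2) → FreeGroup (Fin p ⊕ Fin (p - 2))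
  | Sum.inl i => of (Sum.inl (finRotate p i))
  | Sum.inr j => of (Sum.inr j)

/-- The subgroup `E_R ≤ Out(F_{2(p-1)})` of order `p` coming from the rose
`R_{2(p-1)}` with the identity marking. -/
def ERose (p : ℕ) (h2 : 2 ≤ p) : Subgroup (OutF (2 * (p - 1))) :=
  Subgroup.closure (formalGen (eRose p h2) (rhsRose p))

/-- Basis of `F_{2(p-1)}` adapted to the graph `Θ_{p-1}^{s,p-1-s}`:
`s` loops `a_i` at the base vertex, the `p-1` classes `u_i = b_i b_0⁻¹` of the edges of
`Θ_{p-1}`, and `p-1-s` loops `c_i` at the other vertex (conjugated back to the base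
vertex by the edge `b_0`). -/
def eTheta (p s : ℕ) (hs : s ≤ p - 1) (h2 : 2 ≤ p) :
    Fin s ⊕ (Fin (p - 1) ⊕ Fin (p - 1 - s)) ≃ Fin (2 * (p - 1)) :=
  ((Equiv.refl (Fin s)).sumCongr finSumFinEquiv).trans
    (finSumFinEquiv.trans (finCongr (by omega)))

/-- The generator of `E_{s,p-1-s}`, induced by the graph automorphism of
`Θ_{p-1}^{s,p-1-s}` cyclically rotating the `p` edges of `Θ_{p-1}` and fixing all
attached loops. -/
def rhsTheta (p s : ℕ) (hp : 0 < p - 1) :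
    Fin s ⊕ (Fin (p - 1) ⊕ Fin (p - 1 - s)) →
      FreeGroup (Fin s ⊕ (Fin (p - 1) ⊕ Fin (p - 1 - s)))
  | Sum.inl a => of (Sum.inl a)
  | Sum.inr (Sum.inl k) => FreeGroup.map (fun i => Sum.inr (Sum.inl i)) (rotWord p hp k)
  | Sum.inr (Sum.inr c) =>
      of (Sum.inr (Sum.inl ⟨0, hp⟩)) * of (Sum.inr (Sum.inr c)) *
        (of (Sum.inr (Sum.inl ⟨0, hp⟩)))⁻¹

/-- The subgroup `E_{s,p-1-s} ≤ Out(F_{2(p-1)})` of order `p` coming from the marked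
graph `Θ_{p-1}^{s,p-1-s}`. -/
def ETheta (p s : ℕ) (hs : s ≤ p - 1) (h2 : 2 ≤ p) : Subgroup (OutF (2 * (p - 1))) :=
  Subgroup.closure (formalGen (eTheta p s hs h2) (rhsTheta p s (by omega)))

/-- Basis of `F_{2(p-1)}` adapted to the wedge `Θ_{p-1} ∨ Θ_{p-1}` (based at the wedge
point): the edge classes `u_i` for the left copy and `w_i` for the right copy. -/
def eWedge (p : ℕ) : Fin (p - 1) ⊕ Fin (p - 1) ≃ Fin (2 * (p - 1)) :=
  finSumFinEquiv.trans (finCongr (by omega))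

/-- The automorphism rotating the `p` edges of the left copy of `Θ_{p-1}` in
`Θ_{p-1} ∨ Θ_{p-1}`. -/
def rhsWedgeL (p : ℕ) (hp : 0 < p - 1) :
    Fin (p - 1) ⊕ Fin (p - 1) → FreeGroup (Fin (p - 1) ⊕ Fin (p - 1))
  | Sum.inl k => FreeGroup.map Sum.inl (rotWord p hp k)
  | Sum.inr k => of (Sum.inr k)

/-- The automorphism rotating the `p` edges of the right copy of `Θ_{p-1}` in
`Θ_{p-1} ∨ Θ_{p-1}`. -/
def rhsWedgeR (p : ℕ) (hp : 0 < p - 1) :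
    Fin (p - 1) ⊕ Fin (p - 1) → FreeGroup (Fin (p - 1) ⊕ Fin (p - 1))
  | Sum.inl k => of (Sum.inl k)
  | Sum.inr k => FreeGroup.map Sum.inr (rotWord p hp k)

/-- The diagonal automorphism, rotating the `p` edges of both copies of `Θ_{p-1}`. -/
def rhsWedgeDiag (p : ℕ) (hp : 0 < p - 1) :
    Fin (p - 1) ⊕ Fin (p - 1) → FreeGroup (Fin (p - 1) ⊕ Fin (p - 1))
  | Sum.inl k => FreeGroup.map Sum.inl (rotWord p hp k)
  | Sum.inr k => FreeGroup.map Sum.inr (rotWord p hp k)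

/-- The subgroup `E_2 ≅ Z/p × Z/p` of `Out(F_{2(p-1)})`, generated by the two commuting
edge rotations of the two copies of `Θ_{p-1}` in the marked graph `Θ_{p-1} ∨ Θ_{p-1}`. -/
def E2 (p : ℕ) (h2 : 2 ≤ p) : Subgroup (OutF (2 * (p - 1))) :=
  Subgroup.closure
    (formalGen (eWedge p) (rhsWedgeL p (by omega)) ∪
      formalGen (eWedge p) (rhsWedgeR p (by omega)))

/-- The first factor `Z/p × 1` of `E_2`, generated by the left edge rotation.  Under the
identification of the subgroup `E_{0,p-1}` with a factor of `E_2` this is the subgroup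
denoted `E_{0,p-1}`. -/
def E2Left (p : ℕ) (h2 : 2 ≤ p) : Subgroup (OutF (2 * (p - 1))) :=
  Subgroup.closure (formalGen (eWedge p) (rhsWedgeL p (by omega)))

/-- The diagonal subgroup `Δ(E_2)` of `E_2`. -/
def EDiag (p : ℕ) (h2 : 2 ≤ p) : Subgroup (OutF (2 * (p - 1))) :=
  Subgroup.closure (formalGen (eWedge p) (rhsWedgeDiag p (by omega)))

/-! ### Auxiliary finite groups -/

/-- The symmetric group `Σ_p`. -/
abbrev SymN (p : ℕ) : Type := Equiv.Perm (Fin p)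

/-- The normalizer `N_{Σ_p}(Z/p)` of a subgroup of order `p` of the symmetric group
`Σ_p` (namely of the subgroup generated by the standard `p`-cycle). -/
def NSigma (p : ℕ) : Subgroup (SymN p) :=
  Subgroup.normalizer (Subgroup.zpowers (finRotate p))

/-- The cyclic group `Z/p`, written multiplicatively. -/
abbrev Zc (p : ℕ) : Type := Multiplicative (ZMod p)

/-- `Aut(F_s)`, the automorphism group of the free group of rank `s`. -/
abbrev AutF (s : ℕ) : Type := MulAut (FreeGroup (Fin s))

/-- The homomorphism `Z/2 →* M` sending the generator to a given element whose square
is `1`. -/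
def z2Hom {M : Type*} [Monoid M] (a : M) (ha : a * a = 1) : Zc 2 →* M where
  toFun x := a ^ (Multiplicative.toAdd x).val
  map_one' := by simp
  map_mul' x y := by
    have hsq : a ^ 2 = 1 := by rw [pow_two, ha]
    have key : ∀ m : ℕ, a ^ (m % 2) = a ^ m := by
      intro m
      conv_rhs => rw [← Nat.div_add_mod m 2]
      rw [pow_add, pow_mul, hsq, one_pow, one_mul]
    show a ^ (Multiplicative.toAdd (x * y)).val = _
    have : Multiplicative.toAdd (x * y) = Multiplicative.toAdd x + Multiplicative.toAdd y := rfl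
    rw [this, ZMod.val_add, key, pow_add]

/-- The swap automorphism of `A × A`. -/
def swapAut (A : Type) [Group A] : MulAut (A × A) :=
  (MulEquiv.prodComm : A × A ≃* A × A)

theorem swapAut_sq (A : Type) [Group A] : swapAut A * swapAut A = 1 := by
  ext x
  · rfl
  · rfl

/-- The wreath product `A ≀ Z/2 = (A × A) ⋊ Z/2`, with `Z/2` interchanging the two
factors. -/
def wr2 (A : Type) [Group A] : Type :=
  (A × A) ⋊[z2Hom (swapAut A) (swapAut_sq A)] Zc 2

instance (A : Type) [Group A] : Group (wr2 A) := by
  unfold wr2; infer_instance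

end OutFormal

namespace OutFormal
section WordLemmas
open Monoid Monoid.CoprodI
variable {ι : Type} {M : ι → Type} [∀ i, Group (M i)]

theorem neWord_length_of_prod_eq {i j k l : ι} (w : NeWord M i j) (v : NeWord M k l)
    (h : w.prod = v.prod) : w.toList = v.toList := by
  classical
  have : w.toWord = v.toWord := Word.equiv.symm.injective h
  exact congrArg Word.toList this

theorem neWord_idx_of_prod_eq {i j k l : ι} (w : NeWord M i j) (v : NeWord M k l)
    (h : w.prod = v.prod) : i = k ∧ j = l := by
  have h1 := neWord_length_of_prod_eq w v h
  have h2 := w.toList_head?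
  have h3 := w.toList_getLast?
  rw [h1, v.toList_head?] at h2
  rw [h1, v.toList_getLast?] at h3
  simp only [Option.some.injEq, Sigma.mk.injEq] at h2 h3
  exact ⟨h2.1.symm, h3.1.symm⟩

theorem neWord_prod_ne_one {i j : ι} (w : NeWord M i j) : w.prod ≠ 1 := by
  classical
  intro h
  have : w.toWord = Word.empty := Word.equiv.symm.injective h
  exact w.toList_ne_nil (congrArg Word.toList this)

theorem neWord_length_pos {i j : ι} (w : NeWord M i j) : 1 ≤ w.toList.length :=
  List.length_pos_iff.mpr w.toList_ne_nil

/-- every element is `1` or the product of a nonempty reduced word -/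
theorem exists_neWord (g : CoprodI M) : g = 1 ∨ ∃ i j, ∃ w : NeWord M i j, w.prod = g := by
  classical
  by_cases h : Word.equiv g = Word.empty
  · left
    rw [← Word.equiv.symm_apply_apply g, h]; rfl
  · right
    obtain ⟨i, j, w, hw⟩ := NeWord.of_word _ h
    refine ⟨i, j, w, ?_⟩
    rw [← Word.equiv.symm_apply_apply g, ← hw]; rfl

/-- splitting off a letter from the left -/
theorem left_decomp (i : ι) (g : CoprodI M) : ∃ (x : M i) (t : CoprodI M), g = of x * t ∧
    (t = 1 ∨ ∃ a b, ∃ w : NeWord M a b, a ≠ i ∧ w.prod = t) := by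
  classical
  let P := Word.equivPair i (Word.equiv g)
  have hP : g = of P.head * P.tail.prod := by
    rw [← Word.prod_rcons, ← Word.equivPair_symm]
    simp only [P, Equiv.symm_apply_apply]
    exact (Word.equiv.symm_apply_apply g).symm
  refine ⟨P.head, P.tail.prod, hP, ?_⟩
  by_cases h : P.tail = Word.empty
  · left; rw [h]; rfl
  · right
    obtain ⟨a, b, w, hw⟩ := NeWord.of_word _ h
    refine ⟨a, b, w, ?_, by rw [← hw]; rfl⟩
    have := P.fstIdx_ne
    rw [← hw] at this
    rintro rfl
    apply this
    show Option.map Sigma.fst w.toList.head? = _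
    rw [w.toList_head?]; rfl

/-- Malnormality of the factors. -/
theorem malnormal {i j : ι} {x : M i} {y : M j} (hx : x ≠ 1) (g : CoprodI M)
    (h : g * of x * g⁻¹ = of y) : i = j ∧ ∃ k : M i, g = of k := by
  obtain ⟨k, t, hk, ht⟩ := left_decomp i g⁻¹
  have hg : g = t⁻¹ * of k⁻¹ := by
    rw [← inv_inv g, hk]; simp
  have hc : k⁻¹ * x * k ≠ 1 := by
    intro h'
    apply hx
    have : x = k * (k⁻¹ * x * k) * k⁻¹ := by group
    rw [this, h']; simp
  have hy : y ≠ 1 := by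
    rintro rfl
    rw [map_one, mul_inv_eq_one, mul_eq_left] at h
    exact hx (of_injective i (by rw [h, map_one]))
  have h2 : t⁻¹ * of (k⁻¹ * x * k) * t = of y := by
    rw [← h, hg]; simp [mul_assoc]
  rcases ht with rfl | ⟨a, b, w, ha, rfl⟩
  · have := neWord_idx_of_prod_eq (NeWord.singleton _ hc) (NeWord.singleton y hy)
      (by simpa using h2)
    exact ⟨this.1, k⁻¹, by simpa using hg⟩
  · exfalso
    have := neWord_length_of_prod_eq ((w.inv.append ha (NeWord.singleton _ hc)).append ha.symm w)
      (NeWord.singleton y hy) (by simpa using h2)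
    have := congrArg List.length this
    have := neWord_length_pos w
    have := neWord_length_pos w.inv
    simp at *
    omega

theorem neWord_pow {i j : ι} (w : NeWord M i j) (h : i ≠ j) (n : ℕ) :
    ∃ v : NeWord M i j, v.prod = w.prod ^ (n + 1) := by
  induction n with
  | zero => exact ⟨w, by simp⟩
  | succ n ih =>
    obtain ⟨v, hv⟩ := ih
    exact ⟨v.append h.symm w, by rw [NeWord.append_prod, hv, ← pow_succ]⟩

theorem torsion_aux (n : ℕ) (N : ℕ) : ∀ w : Word M, w.toList.length ≤ N →
    w.prod ^ (n + 1) = 1 → w ≠ Word.empty →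
    ∃ (c : CoprodI M) (i : ι) (x : M i), w.prod = c * of x * c⁻¹ := by
  classical
  induction N with
  | zero =>
    intro w hw _ hne
    exact absurd (Word.ext (by simpa using hw)) hne
  | succ N ih =>
    intro w hw hpow hne
    obtain ⟨a, b, v, hv⟩ := NeWord.of_word w hne
    by_cases hab : a = b
    swap
    · exfalso
      obtain ⟨u, hu⟩ := neWord_pow v hab n
      have : v.prod = w.prod := by rw [← hv]; rfl
      rw [this, hpow] at hu
      exact neWord_prod_ne_one u hu
    subst hab
    have hl : w.toList = v.toList := by rw [← hv]; rfl
    have hhead := v.toList_head?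
    have hlast := v.toList_getLast?
    rw [← hl] at hhead hlast
    obtain ⟨L, hL⟩ := List.head?_eq_some_iff.mp hhead
    rcases List.eq_nil_or_concat L with rfl | ⟨mid, y, rfl⟩
    · refine ⟨1, a, v.head, ?_⟩
      simp [Word.prod, hL]
    · have hy : y = ⟨a, v.last⟩ := by
        rw [hL, List.concat_eq_append, ← List.cons_append, List.getLast?_append] at hlast
        simpa using hlast
      subst hy
      rw [List.concat_eq_append] at hL
      have hch := w.chain_ne
      have hno := w.ne_one
      rw [hL] at hch hno
      let m : Word M := ⟨mid, fun l hl => hno l (by simp [hl]), by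
        have := hch.tail
        simp only [List.tail_cons] at this
        exact this.left_of_append⟩
      have hm : m.fstIdx ≠ some a := by
        rw [Word.fstIdx_ne_iff]
        intro l hl
        have hl' : mid.head? = some l := hl
        obtain ⟨L', hL'⟩ := List.head?_eq_some_iff.mp hl'
        rw [hL'] at hch
        simp only [List.cons_append, List.isChain_cons_cons] at hch
        exact hch.1
      have hprod : w.prod = of v.head * m.prod * of v.last := by
        simp [Word.prod, hL, m, mul_assoc]
      have hlen : w.toList.length = mid.length + 2 := by simp [hL]
      set z := v.last * v.head with hz
      have hconj : w.prod = (of v.last)⁻¹ * (of z * m.prod) * of v.last := by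
        rw [hprod, hz]; simp [mul_assoc]
      have key : ∃ w' : Word M, w'.toList.length ≤ N ∧ w'.prod = of z * m.prod := by
        refine ⟨Word.rcons ⟨z, m, hm⟩, ?_, Word.prod_rcons _⟩
        unfold Word.rcons
        split_ifs
        · show mid.length ≤ N
          omega
        · show (_ :: mid).length ≤ N
          simp; omega
      obtain ⟨w', hlen', hw'⟩ := key
      rw [← hw'] at hconj
      by_cases hne' : w' = Word.empty
      · refine ⟨1, a, 1, ?_⟩
        rw [hconj, hne']; simp
      · have hp' : w'.prod ^ (n + 1) = 1 := by
          have : w'.prod = of v.last * w.prod * (of v.last)⁻¹ := by rw [hconj]; group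
          rw [this, conj_pow, hpow]; simp
        obtain ⟨c, i, x, hc⟩ := ih w' hlen' hp' hne'
        refine ⟨(of v.last)⁻¹ * c, i, x, ?_⟩
        rw [hconj, hc]; simp [mul_assoc]

/-- Elements of finite order are conjugate into a factor. -/
theorem torsion_conj {n : ℕ} (hn : 0 < n) {g : CoprodI M} (hg : g ≠ 1) (h : g ^ n = 1) :
    ∃ (c : CoprodI M) (i : ι) (x : M i), g = c * of x * c⁻¹ := by
  classical
  obtain ⟨m, rfl⟩ := Nat.exists_eq_succ_of_ne_zero hn.ne'
  have hw : (Word.equiv g).prod = g := Word.equiv.symm_apply_apply g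
  have := torsion_aux m _ (Word.equiv g) le_rfl (by rw [hw]; exact h)
    (by intro h'; rw [h'] at hw; exact hg hw.symm)
  rwa [hw] at this

end WordLemmas

section Gen
open Monoid Monoid.CoprodI
variable {M : Bool → Type} [∀ i, Group (M i)]

theorem theta_neWord (i : Bool) (v : NeWord M (!i) i) (θ : CoprodI M →* CoprodI M)
    (h1 : ∀ x : M i, θ (of x) = of x) (h2 : ∀ x : M (!i), θ (of x) = v.prod * of x * v.prod⁻¹)
    {a b : Bool} (w : NeWord M a b) :
    ∃ w' : NeWord M a b, w'.prod = θ w.prod ∧ (a = i ∨ 2 ≤ w'.toList.length) := by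
  have hne : i ≠ !i := by cases i <;> simp
  induction w with
  | @singleton a x hx =>
    by_cases ha : a = i
    · subst ha
      exact ⟨NeWord.singleton x hx, by simp [h1], Or.inl rfl⟩
    · obtain rfl : a = !i := by cases a <;> cases i <;> simp_all
      refine ⟨(v.append hne (NeWord.singleton x hx)).append hne.symm v.inv, by simp [h2], Or.inr ?_⟩
      have := neWord_length_pos v
      simp; omega
  | append w₁ hne w₂ ih₁ ih₂ =>
    obtain ⟨u₁, hu₁, _⟩ := ih₁
    obtain ⟨u₂, hu₂, _⟩ := ih₂
    refine ⟨u₁.append hne u₂, by simp [hu₁, hu₂], Or.inr ?_⟩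
    have := neWord_length_pos u₁
    have := neWord_length_pos u₂
    simp; omega

/-- If `M i` and `g (M !i) g⁻¹` generate, then `g ∈ (M i) (M !i)`. -/
theorem gen_lemma (i : Bool) [Nontrivial (M (!i))] (g : CoprodI M)
    (hgen : ∀ T : Subgroup (CoprodI M), (∀ x : M i, of x ∈ T) →
      (∀ x : M (!i), g * of x * g⁻¹ ∈ T) → T = ⊤) :
    ∃ (x : M i) (y : M (!i)), g = of x * of y := by
  classical
  have hne : i ≠ !i := by cases i <;> simp
  obtain ⟨x, t, hg, ht⟩ := left_decomp i g
  rcases ht with rfl | ⟨a, b, w, ha, rfl⟩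
  · exact ⟨x, 1, by simpa using hg⟩
  obtain rfl : a = !i := by cases a <;> cases i <;> simp_all
  -- general contradiction
  have key : ∀ (v : NeWord M (!i) i) (y : M (!i)), g = of x * v.prod * of y → False := by
    intro v y hgv
    let f : ∀ b, M b →* CoprodI M := fun b => if b = i then of else
      (MulAut.conj v.prod).toMonoidHom.comp of
    have h1 : ∀ x : M i, lift f (of x) = of x := by intro x; simp [f]
    have h2 : ∀ x : M (!i), lift f (of x) = v.prod * of x * v.prod⁻¹ := by
      intro x; simp [f, hne.symm]
    have hT := hgen ((lift f).range.comap (MulAut.conj (of x)⁻¹).toMonoidHom)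
      (fun z => ⟨of (x⁻¹ * z * x), by rw [h1]; simp⟩)
      (fun z => ⟨of (y * z * y⁻¹), by rw [h2, hgv]; simp [mul_assoc]⟩)
    obtain ⟨z, hz⟩ := exists_ne (1 : M (!i))
    have hm : of x * of z * (of x)⁻¹ ∈
      (lift f).range.comap (MulAut.conj (of x)⁻¹).toMonoidHom := by rw [hT]; trivial
    obtain ⟨q, hq⟩ := hm
    have hq' : lift f q = of z := by rw [hq]; simp [mul_assoc]
    rcases exists_neWord q with rfl | ⟨a, b, u, rfl⟩
    · rw [map_one] at hq'
      exact hz (of_injective _ (by rw [← hq', map_one]))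
    · obtain ⟨u', hu', hor⟩ := theta_neWord i v _ h1 h2 u
      rw [hq', ← NeWord.prod_singleton z hz] at hu'
      rcases hor with rfl | hlen
      · exact hne (neWord_idx_of_prod_eq _ _ hu').1
      · rw [neWord_length_of_prod_eq _ _ hu'] at hlen
        simp at hlen
  by_cases hb : b = i
  · subst hb
    exact (key w 1 (by simpa using hg)).elim
  obtain rfl : b = !i := by cases b <;> cases i <;> simp_all
  have hlast := w.toList_getLast?
  obtain ⟨L, hL⟩ := List.getLast?_eq_some_iff.mp hlast
  by_cases hnil : L = []
  · refine ⟨x, w.last, ?_⟩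
    rw [hg]; congr 1
    show w.toWord.prod = _
    have : w.toWord.toList = w.toList := rfl
    simp [Word.prod, this, hL, hnil]
  · exfalso
    have hch := w.toWord.chain_ne
    have hno := w.toWord.ne_one
    have hww : w.toWord.toList = w.toList := rfl
    rw [hww, hL] at hch hno
    let m : Word M := ⟨L, fun l hl => hno l (by simp [hl]), hch.left_of_append⟩
    have hm : m ≠ Word.empty := fun h => hnil (congrArg Word.toList h)
    obtain ⟨c, d, v, hv⟩ := NeWord.of_word m hm
    have hvL : v.toList = L := congrArg Word.toList hv
    have hc : c = !i := by
      have h3 := w.toList_head?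
      rw [hL, ← hvL, List.head?_append, v.toList_head?] at h3
      simp only [Option.some_or, Option.some.injEq, Sigma.mk.injEq] at h3
      exact h3.1
    have hd : d ≠ !i := by
      rw [List.isChain_append] at hch
      exact hch.2.2 ⟨d, v.last⟩ (by rw [← hvL, v.toList_getLast?]; rfl) ⟨_, w.last⟩ (by simp)
    subst hc
    obtain rfl : d = i := by cases d <;> cases i <;> simp_all
    refine key v w.last ?_
    rw [hg, mul_assoc]; congr 1
    show w.toWord.prod = v.toWord.prod * _
    rw [hv]
    simp [Word.prod, hww, hL, m]
end Gen
section Abs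
variable {K Γ Q : Type} [Group K] [Group Γ] [CommGroup Q]

/-- automorphisms compatible with `π` -/
def Api (π : Γ →* Q) : Subgroup (MulAut Γ) where
  carrier := {α | ∀ g, π (α g) = π g}
  one_mem' g := rfl
  mul_mem' {a b} ha hb g := by
    rw [MulAut.mul_apply, ha, hb]
  inv_mem' {a} ha g := by
    have := ha (a⁻¹ g)
    rw [MulAut.apply_inv_self] at this
    exact this.symm

theorem Api_spec {π : Γ →* Q} (α : Api π) (g : Γ) : π (α.1 g) = π g := α.2 g

/-- inner automorphisms as elements of `Api` -/
def conjA (π : Γ →* Q) : Γ →* Api π :=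
  (MulAut.conj : Γ →* MulAut Γ).codRestrict (Api π) (fun g h => by
    simp [MulAut.conj_apply])

theorem conjA_apply (π : Γ →* Q) (g h : Γ) : (conjA π g).1 h = g * h * g⁻¹ := rfl

variable {π : Γ →* Q} {j : K →* Γ}

theorem R_ex (hr : ∀ g, π g = 1 ↔ ∃ k, j k = g) (α : Api π) (k : K) :
    ∃ k', j k' = α.1 (j k) :=
  (hr _).1 (by rw [Api_spec, (hr _).2 ⟨k, rfl⟩])

/-- restriction of automorphisms to the kernel -/
def Rfun (hr : ∀ g, π g = 1 ↔ ∃ k, j k = g) (α : Api π) (k : K) : K :=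
  (R_ex hr α k).choose

theorem Rfun_spec (hr : ∀ g, π g = 1 ↔ ∃ k, j k = g) (α : Api π) (k : K) :
    j (Rfun hr α k) = α.1 (j k) := (R_ex hr α k).choose_spec

/-- restriction of automorphisms to the kernel -/
def Rhom (hj : Function.Injective j) (hr : ∀ g, π g = 1 ↔ ∃ k, j k = g) :
    Api π →* MulAut K where
  toFun α :=
    { toFun := Rfun hr α
      invFun := Rfun hr α⁻¹
      left_inv := fun k => hj (by
        rw [Rfun_spec, Rfun_spec]; exact MulAut.inv_apply_self _ _ _)
      right_inv := fun k => hj (by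
        rw [Rfun_spec, Rfun_spec]; exact MulAut.apply_inv_self _ _ _)
      map_mul' := fun a b => hj (by
        rw [map_mul, Rfun_spec, Rfun_spec, Rfun_spec, map_mul, map_mul]) }
  map_one' := by
    ext k
    exact hj (Rfun_spec hr 1 k)
  map_mul' α β := by
    ext k
    apply hj
    show j (Rfun hr _ k) = j (Rfun hr _ (Rfun hr _ k))
    rw [Rfun_spec, Rfun_spec, Rfun_spec]; rfl

theorem Rhom_spec (hj : Function.Injective j) (hr : ∀ g, π g = 1 ↔ ∃ k, j k = g)
    (α : Api π) (k : K) : j (Rhom hj hr α k) = α.1 (j k) := Rfun_spec hr α k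

theorem Rhom_conj (hj : Function.Injective j) (hr : ∀ g, π g = 1 ↔ ∃ k, j k = g) (k : K) :
    Rhom hj hr (conjA π (j k)) = MulAut.conj k := by
  ext l
  apply hj
  rw [Rhom_spec, conjA_apply, MulAut.conj_apply]; simp

theorem mk_eq_one {ψ : MulAut K} : Out.mk K ψ = 1 ↔ ∃ k, MulAut.conj k = ψ :=
  QuotientGroup.eq_one_iff (N := (MulAut.conj : K →* MulAut K).range) ψ

theorem mk_Rhom_conj (hj : Function.Injective j) (hr : ∀ g, π g = 1 ↔ ∃ k, j k = g) (k : K) :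
    Out.mk K (Rhom hj hr (conjA π (j k))) = 1 := by
  rw [Rhom_conj]; exact mk_eq_one.2 ⟨k, rfl⟩

/-- an automorphism in `Api` which agrees with an inner one on the kernel is inner -/
theorem Rhom_inj (hj : Function.Injective j) (hr : ∀ g, π g = 1 ↔ ∃ k, j k = g)
    (hC : ∀ g : Γ, (∀ k, g * j k = j k * g) → g = 1) :
    Function.Injective (Rhom hj hr) := by
  rw [injective_iff_map_eq_one]
  intro δ h
  have hfix : ∀ k, δ.1 (j k) = j k := by
    intro k; rw [← Rhom_spec hj hr, h]; rfl
  ext g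
  show δ.1 g = g
  have : g⁻¹ * δ.1 g = 1 := by
    apply hC
    intro k
    obtain ⟨k', hk'⟩ := R_ex hr (conjA π g) k
    rw [conjA_apply] at hk'
    have h1 := hfix k'
    rw [hk', map_mul, map_mul, map_inv, hfix] at h1
    have h2 : δ.1 g * j k = g * j k * g⁻¹ * δ.1 g := by rw [← h1]; group
    rw [mul_assoc, h2]; group
  rw [inv_mul_eq_one] at this
  exact this.symm

theorem ext_exists (hj : Function.Injective j) (hr : ∀ g, π g = 1 ↔ ∃ k, j k = g)
    (hC : ∀ g : Γ, (∀ k, g * j k = j k * g) → g = 1) (ψ : MulAut K)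
    (hψ : ∀ g, Commute (Out.mk K ψ) (Out.mk K (Rhom hj hr (conjA π g)))) :
    ∃ α : Api π, Rhom hj hr α = ψ := by
  set ρ : Γ →* MulAut K := (Rhom hj hr).comp (conjA π) with hρ
  have hρi : Function.Injective ρ := by
    rw [injective_iff_map_eq_one]
    intro g hg
    have h1 : conjA π g = 1 := Rhom_inj hj hr hC (by rw [map_one]; exact hg)
    apply hC
    intro k
    have : g * j k * g⁻¹ = j k := by rw [← conjA_apply π, h1]; rfl
    rwa [mul_inv_eq_iff_eq_mul] at this
  have main : ∀ ψ : MulAut K, (∀ g, Commute (Out.mk K ψ) (Out.mk K (ρ g))) →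
      ∀ g, ∃ g', ρ g' = ψ * ρ g * ψ⁻¹ ∧ π g' = π g := by
    intro ψ hψ g
    have h1 : Out.mk K ((ρ g)⁻¹ * (ψ * ρ g * ψ⁻¹)) = 1 := by
      simp only [map_mul, map_inv, (hψ g).eq]
      group
    obtain ⟨k, hk⟩ := mk_eq_one.1 h1
    refine ⟨g * j k, ?_, ?_⟩
    · rw [map_mul]
      have : ρ (j k) = MulAut.conj k := Rhom_conj hj hr k
      rw [this, hk]; group
    · rw [map_mul, (hr (j k)).2 ⟨k, rfl⟩, mul_one]
  have hψ' : ∀ g, Commute (Out.mk K ψ⁻¹) (Out.mk K (ρ g)) := by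
    intro g
    rw [map_inv]; exact (hψ g).inv_left
  choose f hf hfπ using main ψ hψ
  choose f' hf' hfπ' using main ψ⁻¹ hψ'
  let α : MulAut Γ :=
    { toFun := f
      invFun := f'
      left_inv := fun g => hρi (by rw [hf', hf]; group)
      right_inv := fun g => hρi (by rw [hf, hf']; group)
      map_mul' := fun a b => hρi (by rw [map_mul, hf, hf, hf, map_mul]; group) }
  refine ⟨⟨α, hfπ⟩, ?_⟩
  ext k
  apply hj
  rw [Rhom_spec]
  apply hρi
  show ρ (f (j k)) = _
  have hk : ∀ k, ρ (j k) = MulAut.conj k := fun k => Rhom_conj hj hr k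
  rw [hf, hk, hk]
  ext l
  simp

theorem main_abs (hj : Function.Injective j) (hr : ∀ g, π g = 1 ↔ ∃ k, j k = g)
    (hC : ∀ g : Γ, (∀ k, g * j k = j k * g) → g = 1)
    (z : Q →* Γ) (hz : ∀ x, π (z x) = x) (q : Q) (hq : ∀ x : Q, x ∈ Subgroup.zpowers q)
    {B : Type} [Group B] (β : B →* Api π)
    (hI : ∀ b g, β b = conjA π g → g = 1 ∧ b = 1)
    (hII : ∀ α : Api π, ∃ g b, α = conjA π g * β b) :
    Nonempty (Subgroup.centralizer
      ((Subgroup.closure {Out.mk K (Rhom hj hr (conjA π (z q)))} : Subgroup (Out K)) :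
        Set (Out K)) ≃* Q × B) := by
  set Z := Subgroup.centralizer
      ((Subgroup.closure {Out.mk K (Rhom hj hr (conjA π (z q)))} : Subgroup (Out K)) :
        Set (Out K)) with hZ
  set μ : Api π →* Out K := (Out.mk K).comp (Rhom hj hr) with hμ
  have hdec : ∀ g : Γ, ∃ k, g = z (π g) * j k := by
    intro g
    obtain ⟨k, hk⟩ := (hr ((z (π g))⁻¹ * g)).1 (by simp [hz])
    exact ⟨k, by rw [hk]; group⟩
  have hμj : ∀ k, μ (conjA π (j k)) = 1 := mk_Rhom_conj hj hr
  have hμg : ∀ g, μ (conjA π g) = μ (conjA π (z (π g))) := by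
    intro g
    obtain ⟨k, hk⟩ := hdec g
    conv_lhs => rw [hk, map_mul, map_mul, hμj, mul_one]
  have hcomm : ∀ (α : Api π) (g : Γ), Commute (μ α) (μ (conjA π g)) := by
    intro α g
    have h1 : α * conjA π g * α⁻¹ = conjA π (α.1 g) := by
      ext h
      show α.1 (g * (α.1⁻¹ h) * g⁻¹) = α.1 g * h * (α.1 g)⁻¹
      simp
    have h2 : μ (α * conjA π g * α⁻¹) = μ (conjA π g) := by
      rw [h1, hμg, Api_spec, ← hμg]
    rw [map_mul, map_mul, map_inv, mul_inv_eq_iff_eq_mul] at h2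
    exact h2
  have hmemZ : ∀ x, x ∈ Z ↔ ∀ g, Commute x (μ (conjA π g)) := by
    intro x
    rw [hZ, Subgroup.centralizer_closure, Subgroup.mem_centralizer_singleton_iff]
    constructor
    · intro h g
      rw [hμg]
      obtain ⟨m, hm⟩ := hq (π g)
      have hm' : q ^ m = π g := hm
      rw [← hm', map_zpow, map_zpow, map_zpow]
      exact Commute.zpow_right h m
    · intro h
      exact h (z q)
  let Θ : Q × B →* Out K := MonoidHom.noncommCoprod ((μ.comp (conjA π)).comp z) (μ.comp β)
    (fun m n => (hcomm (β n) (z m)).symm)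
  have hΘ : ∀ x b, Θ (x, b) = μ (conjA π (z x) * β b) := by
    intro x b
    simp [Θ, MonoidHom.noncommCoprod_apply]
  have hΘZ : ∀ y, Θ y ∈ Z := by
    rintro ⟨x, b⟩
    rw [hmemZ]
    intro g
    rw [hΘ]; exact hcomm _ _
  let Θ' : Q × B →* Z := Θ.codRestrict Z hΘZ
  refine ⟨(MulEquiv.ofBijective Θ' ⟨?_, ?_⟩).symm⟩
  · rw [injective_iff_map_eq_one]
    rintro ⟨x, b⟩ h
    have h1 : Θ (x, b) = 1 := congrArg Subtype.val h
    rw [hΘ] at h1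
    obtain ⟨k, hk⟩ := mk_eq_one.1 h1
    rw [← Rhom_conj hj hr k] at hk
    have h2 := Rhom_inj hj hr hC hk
    have h3 : β b = conjA π ((z x)⁻¹ * j k) := by
      rw [map_mul, h2, map_inv]; group
    obtain ⟨h4, rfl⟩ := hI _ _ h3
    have h5 := congrArg π h4
    rw [map_mul, map_inv, hz, (hr (j k)).2 ⟨k, rfl⟩, mul_one, map_one, inv_eq_one] at h5
    rw [h5]; rfl
  · rintro ⟨x, hx⟩
    obtain ⟨ψ, rfl⟩ : ∃ ψ, Out.mk K ψ = x := QuotientGroup.mk'_surjective _ x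
    rw [hmemZ] at hx
    obtain ⟨α, rfl⟩ := ext_exists hj hr hC ψ hx
    obtain ⟨g, b, hgb⟩ := hII α
    refine ⟨(π g, b), Subtype.ext ?_⟩
    show Θ (π g, b) = μ α
    rw [hΘ, hgb, map_mul, map_mul, ← hμg]
end Abs
section Cls
open Monoid Monoid.CoprodI
variable (p : ℕ) (A : Bool → Type) [∀ b, Group (A b)]

/-- the factors -/
abbrev Hf (b : Bool) : Type := A b × Zc p

/-- the free product -/
abbrev G0 : Type := CoprodI (Hf p A)

/-- the projection to `Z/p` -/
def pr : G0 p A →* Zc p := lift (fun b => MonoidHom.snd (A b) (Zc p))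

variable {p A}

theorem pr_of {b : Bool} (x : Hf p A b) : pr p A (of x) = x.2 := by simp [pr]

variable (p A)

/-- the embeddings of `Z/p` -/
def zz (b : Bool) : Zc p →* G0 p A := (of (M := Hf p A) (i := b)).comp (MonoidHom.inr (A b) (Zc p))

/-- the generator -/
def zg (b : Bool) : G0 p A := zz p A b (Multiplicative.ofAdd 1)

variable {p A}

theorem zz_apply (b : Bool) (x : Zc p) : zz p A b x = of (M := Hf p A) (i := b) (1, x) := rfl

theorem pr_zz (b : Bool) (x : Zc p) : pr p A (zz p A b x) = x := pr_of _

theorem gen_ne_one (hp : 1 < p) : (Multiplicative.ofAdd 1 : Zc p) ≠ 1 := by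
  have : Fact (1 < p) := ⟨hp⟩
  intro h
  exact one_ne_zero (α := ZMod p) (Multiplicative.ofAdd.injective h)

theorem gen_pow (hp : 1 < p) (x : Zc p) :
    x = (Multiplicative.ofAdd 1 : Zc p) ^ (Multiplicative.toAdd x).val := by
  have : NeZero p := ⟨by omega⟩
  apply Multiplicative.toAdd.injective
  simp

theorem zel_ne_one (hp : 1 < p) (b : Bool) : ((1, Multiplicative.ofAdd 1) : Hf p A b) ≠ 1 := by
  intro h
  exact gen_ne_one hp (congrArg Prod.snd h)

/-- the centralizer of the generator is the factor -/
theorem comm_zg (hp : 1 < p) {b : Bool} {g : G0 p A} (h : g * zg p A b = zg p A b * g) :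
    ∃ x : Hf p A b, g = of x := by
  refine (malnormal (zel_ne_one hp b) g (y := ((1, Multiplicative.ofAdd 1) : Hf p A b)) ?_).2
  exact mul_inv_eq_iff_eq_mul.2 h

theorem zg_comm (b : Bool) (x : Hf p A b) : of x * zg p A b = zg p A b * of x := by
  rw [zg, zz_apply, ← map_mul, ← map_mul]
  congr 1
  ext
  · simp
  · simp [mul_comm]

theorem zg_conj_ne (hp : 1 < p) {b c : Bool} (g : G0 p A)
    (h : g * zg p A b * g⁻¹ = zg p A c) : b = c :=
  (malnormal (zel_ne_one hp b) g (y := ((1, Multiplicative.ofAdd 1) : Hf p A c)) h).1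

theorem both_of (g : G0 p A) (h1 : ∃ x : Hf p A true, g = of x)
    (h2 : ∃ x : Hf p A false, g = of x) : g = 1 := by
  obtain ⟨x, hx⟩ := h1
  obtain ⟨y, hy⟩ := h2
  by_cases hx1 : x = 1
  · rw [hx, hx1, map_one]
  · have := (malnormal hx1 (1 : G0 p A) (y := y) (by rw [← hx, ← hy]; simp)).1
    simp at this

theorem fix_both (hp : 1 < p) {g : G0 p A} (h : ∀ b, g * zg p A b * g⁻¹ = zg p A b) : g = 1 :=
  both_of g (comm_zg hp (mul_inv_eq_iff_eq_mul.1 (h true)))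
    (comm_zg hp (mul_inv_eq_iff_eq_mul.1 (h false)))

section
variable [∀ b, IsMulTorsionFree (A b)]

theorem image_zg (hp : 1 < p) (α : Api (pr p A)) (b : Bool) :
    ∃ g i, α.1 (zg p A b) = g * zg p A i * g⁻¹ := by
  have hpow : (α.1 (zg p A b)) ^ p = 1 := by
    rw [← map_pow, zg, ← map_pow]
    have : (Multiplicative.ofAdd 1 : Zc p) ^ p = 1 := by
      apply Multiplicative.toAdd.injective
      simp
    rw [this, map_one, map_one]
  have hpr : pr p A (α.1 (zg p A b)) = Multiplicative.ofAdd 1 := by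
    rw [Api_spec, zg, pr_zz]
  have hne : α.1 (zg p A b) ≠ 1 := by
    intro h
    rw [h, map_one] at hpr
    exact gen_ne_one hp hpr.symm
  obtain ⟨c, i, x, hx⟩ := torsion_conj (by omega) hne hpow
  refine ⟨c, i, ?_⟩
  rw [hx, map_mul, map_mul, map_inv, mul_comm, inv_mul_cancel_left, pr_of] at hpr
  rw [hx, conj_pow, mul_inv_eq_one, mul_eq_left, ← map_pow] at hpow
  have hx2 : x ^ p = 1 := of_injective i (by rw [hpow, map_one])
  have hx3 : x.1 ^ p = 1 := congrArg Prod.fst hx2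
  have hx4 : x.1 = 1 := by
    rwa [pow_eq_one_iff_left (by omega : p ≠ 0)] at hx3
  have : x = (1, Multiplicative.ofAdd 1) := Prod.ext hx4 hpr
  rw [hx, this]; rfl
end

theorem image_of (hp : 1 < p) (γ : Api (pr p A)) {b c : Bool} (h : γ.1 (zg p A b) = zg p A c)
    (x : Hf p A b) : ∃ y : Hf p A c, γ.1 (of x) = of y := by
  apply comm_zg hp
  rw [← h, ← map_mul, ← map_mul, zg_comm]

theorem classify [∀ b, IsMulTorsionFree (A b)] (hp : 1 < p) (α : Api (pr p A)) :
    ∃ g γ, α = conjA (pr p A) g * γ ∧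
      ((∀ b, γ.1 (zg p A b) = zg p A b) ∨ (∀ b, γ.1 (zg p A b) = zg p A (!b))) := by
  obtain ⟨g1, i, h1⟩ := image_zg hp α true
  obtain ⟨g2, k, h2⟩ := image_zg hp α false
  have hk : k = !i := by
    have hne : k ≠ i := by
      rintro rfl
      have h3 : (g1 * g2⁻¹) * α.1 (zg p A false) * (g1 * g2⁻¹)⁻¹ = α.1 (zg p A true) := by
        rw [h1, h2]; group
      have h4 := congrArg (fun w => (α.1⁻¹ : MulAut _) w) h3
      simp only [map_mul, map_inv, MulAut.inv_apply_self] at h4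
      rw [← map_inv, ← map_mul] at h4
      have := zg_conj_ne hp _ h4
      simp at this
    cases k <;> cases i <;> simp_all
  subst hk
  set α1 : Api (pr p A) := conjA (pr p A) g1⁻¹ * α with hα1
  set g := g1⁻¹ * g2 with hg
  have ht : α1.1 (zg p A true) = zg p A i := by
    show g1⁻¹ * α.1 _ * g1⁻¹⁻¹ = _
    rw [h1]; group
  have hf : α1.1 (zg p A false) = g * zg p A (!i) * g⁻¹ := by
    show g1⁻¹ * α.1 _ * g1⁻¹⁻¹ = _
    rw [h2, hg]; group
  have hf' : (conjA (pr p A) g⁻¹ * α1).1 (zg p A false) = zg p A (!i) := by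
    show g⁻¹ * α1.1 _ * g⁻¹⁻¹ = _
    rw [hf]; group
  have : Nontrivial (Hf p A (!i)) := ⟨⟨_, _, zel_ne_one hp (!i)⟩⟩
  obtain ⟨x, y, hxy⟩ := gen_lemma i g (by
    intro T hT1 hT2
    have : ∀ w, α1.1 w ∈ T := by
      intro w
      induction w using CoprodI.induction_on with
      | one => rw [map_one]; exact T.one_mem
      | of b m =>
        cases b with
        | true =>
          obtain ⟨y, hy⟩ := image_of hp α1 ht m
          rw [hy]; exact hT1 y
        | false =>
          obtain ⟨y, hy⟩ := image_of hp _ hf' m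
          have h5 : g⁻¹ * α1.1 (of m) * g⁻¹⁻¹ = of y := hy
          have h6 : α1.1 (of m) = g * of y * g⁻¹ := by rw [← h5]; group
          rw [h6]; exact hT2 y
      | mul a b ha hb => rw [map_mul]; exact T.mul_mem ha hb
    rw [eq_top_iff]
    intro w _
    have := this (α1.1⁻¹ w)
    rwa [MulAut.apply_inv_self] at this)
  refine ⟨g1 * of x, conjA (pr p A) (of x)⁻¹ * α1, ?_, ?_⟩
  · rw [hα1]; simp only [map_mul, map_inv]; group
  · have h7 : (conjA (pr p A) (of x)⁻¹ * α1).1 (zg p A true) = zg p A i := by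
      show (of x)⁻¹ * α1.1 _ * (of x)⁻¹⁻¹ = _
      rw [ht, inv_inv, mul_assoc, ← zg_comm, inv_mul_cancel_left]
    have h8 : (conjA (pr p A) (of x)⁻¹ * α1).1 (zg p A false) = zg p A (!i) := by
      show (of x)⁻¹ * α1.1 _ * (of x)⁻¹⁻¹ = _
      rw [hf, hxy]
      have := zg_comm (!i) y
      have h9 : zg p A (!i) = of y * zg p A (!i) * (of y)⁻¹ := by rw [this]; group
      conv_rhs => rw [h9]
      group
    cases i with
    | true => left; intro b; cases b <;> assumption
    | false => right; intro b; cases b <;> assumption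

theorem image_zz (hp : 1 < p) (γ : Api (pr p A)) {b c : Bool} (h : γ.1 (zg p A b) = zg p A c)
    (x : Zc p) : γ.1 (zz p A b x) = zz p A c x := by
  rw [gen_pow hp x, map_pow, map_pow, map_pow]
  exact congrArg (· ^ _) h

theorem image_hom (hp : 1 < p) (γ : Api (pr p A)) {b c : Bool} (h : γ.1 (zg p A b) = zg p A c) :
    ∃ f : A b →* A c, ∀ x : Hf p A b, γ.1 (of x) = of (M := Hf p A) (i := c) (f x.1, x.2) := by
  classical
  let f : A b →* A c := (MonoidHom.fst (A c) (Zc p)).comp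
    ((lift (Pi.mulSingle c (MonoidHom.id (Hf p A c)))).comp
      (γ.1.toMonoidHom.comp ((of (M := Hf p A) (i := b)).comp (MonoidHom.inl (A b) (Zc p)))))
  have hf : ∀ a : A b, γ.1 (of (M := Hf p A) (i := b) (a, 1)) =
      of (M := Hf p A) (i := c) (f a, 1) := by
    intro a
    obtain ⟨y, hy⟩ := image_of hp γ h (a, 1)
    have h1 : f a = y.1 := by
      show (lift (Pi.mulSingle c (MonoidHom.id (Hf p A c)))
        (γ.1 (of (M := Hf p A) (i := b) (a, 1)))).1 = _
      rw [hy, of_leftInverse]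
    have h2 := Api_spec γ (of (M := Hf p A) (i := b) (a, 1))
    rw [hy, pr_of, pr_of] at h2
    rw [hy, h1]
    congr 1
    exact Prod.ext rfl h2
  refine ⟨f, ?_⟩
  rintro ⟨a, x⟩
  have h3 : of (M := Hf p A) (i := b) (a, x) = of (M := Hf p A) (i := b) (a, 1) * zz p A b x := by
    rw [zz_apply, ← map_mul]; simp
  rw [h3, map_mul, hf, image_zz hp γ h, zz_apply, ← map_mul]; simp

theorem image_equiv (hp : 1 < p) (γ : Api (pr p A)) {b c : Bool}
    (h : γ.1 (zg p A b) = zg p A c) :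
    ∃ f : A b ≃* A c, ∀ x : Hf p A b, γ.1 (of x) = of (M := Hf p A) (i := c) (f x.1, x.2) := by
  have h' : (γ⁻¹).1 (zg p A c) = zg p A b := by
    rw [← h]; exact MulAut.inv_apply_self _ _ _
  obtain ⟨f, hf⟩ := image_hom hp γ h
  obtain ⟨f', hf'⟩ := image_hom hp γ⁻¹ h'
  refine ⟨MulEquiv.mk' ⟨f, f', fun a => ?_, fun a => ?_⟩ f.map_mul, hf⟩
  · have h1 : (γ⁻¹).1 (γ.1 (of (M := Hf p A) (i := b) (a, 1))) = _ := MulAut.inv_apply_self _ _ _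
    rw [hf, hf'] at h1
    exact congrArg Prod.fst (of_injective b h1)
  · have h1 : γ.1 ((γ⁻¹).1 (of (M := Hf p A) (i := c) (a, 1))) = _ := MulAut.apply_inv_self _ _ _
    rw [hf', hf] at h1
    exact congrArg Prod.fst (of_injective c h1)

/-- two automorphisms agreeing on the factors are equal -/
theorem Api_ext {γ δ : Api (pr p A)} (h : ∀ b (x : Hf p A b), γ.1 (of x) = δ.1 (of x)) :
    γ = δ := by
  apply Subtype.ext
  have : γ.1.toMonoidHom = δ.1.toMonoidHom := by
    apply CoprodI.ext_hom
    intro b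
    ext x : 1
    exact h b x
  ext g
  exact DFunLike.congr_fun this g

/-- the endomorphism of the free product induced by endomorphisms of the factors -/
def mapE (f : ∀ b, A b →* A b) : G0 p A →* G0 p A :=
  lift (fun b => (of (M := Hf p A) (i := b)).comp ((f b).prodMap (MonoidHom.id _)))

theorem mapE_of (f : ∀ b, A b →* A b) {b : Bool} (x : Hf p A b) :
    mapE f (of x) = of (M := Hf p A) (i := b) (f b x.1, x.2) := by
  simp [mapE]; rfl

theorem mapE_inv (f g : ∀ b, A b →* A b) (h : ∀ b a, g b (f b a) = a) (w : G0 p A) :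
    mapE g (mapE f w) = w := by
  have : (mapE (p := p) g).comp (mapE f) = MonoidHom.id _ := by
    apply CoprodI.ext_hom
    intro b
    ext x : 1
    simp [mapE_of, h]
  exact DFunLike.congr_fun this w

/-- the pair of automorphisms as a family -/
def fam (x : MulAut (A true) × MulAut (A false)) : ∀ b, MulAut (A b)
  | true => x.1
  | false => x.2

theorem fam_mul (x y : MulAut (A true) × MulAut (A false)) (b : Bool) :
    fam (x * y) b = fam x b * fam y b := by
  cases b <;> rfl

theorem fam_inv (x : MulAut (A true) × MulAut (A false)) (b : Bool) :
    fam x⁻¹ b = (fam x b)⁻¹ := by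
  cases b <;> rfl

theorem fam_one (b : Bool) : fam (1 : MulAut (A true) × MulAut (A false)) b = 1 := by
  cases b <;> rfl

variable (p A)
/-- the automorphism of the free product attached to a pair -/
def aut1 (x : MulAut (A true) × MulAut (A false)) : Api (pr p A) := ⟨
    { toFun := mapE (fun b => (fam x b).toMonoidHom)
      invFun := mapE (fun b => (fam x⁻¹ b).toMonoidHom)
      left_inv := fun w => mapE_inv _ _ (fun b a => by
        rw [fam_inv]; exact MulAut.inv_apply_self _ _ _) w
      right_inv := fun w => mapE_inv _ _ (fun b a => by
        rw [fam_inv]; exact MulAut.apply_inv_self _ _ _) w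
      map_mul' := map_mul _ }, by
    intro g
    have : (pr p A).comp (mapE (fun b => (fam x b).toMonoidHom)) = pr p A := by
      apply CoprodI.ext_hom
      intro b
      ext y : 1
      simp [mapE_of, pr_of]
    exact DFunLike.congr_fun this g⟩
variable {p A}

theorem aut1_of (x : MulAut (A true) × MulAut (A false)) {b : Bool} (y : Hf p A b) :
    (aut1 p A x).1 (of y) = of (M := Hf p A) (i := b) (fam x b y.1, y.2) :=
  mapE_of (fun b => (fam x b).toMonoidHom) y

variable (p A)
/-- the automorphisms preserving both factors -/
def beta1 : MulAut (A true) × MulAut (A false) →* Api (pr p A) where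
  toFun x := aut1 p A x
  map_one' := by
    apply Api_ext
    intro b x
    rw [aut1_of, fam_one]; rfl
  map_mul' x y := by
    apply Api_ext
    intro b z
    have h : (aut1 p A x * aut1 p A y).1 (of z) = (aut1 p A x).1 ((aut1 p A y).1 (of z)) := rfl
    rw [h, aut1_of, aut1_of, aut1_of, fam_mul]; rfl
variable {p A}

theorem beta1_of (x : MulAut (A true) × MulAut (A false)) {b : Bool} (y : Hf p A b) :
    (beta1 p A x).1 (of y) = of (M := Hf p A) (i := b) (fam x b y.1, y.2) :=
  aut1_of x y

theorem beta1_zg (x : MulAut (A true) × MulAut (A false)) (b : Bool) :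
    (beta1 p A x).1 (zg p A b) = zg p A b := by
  rw [zg, zz_apply, beta1_of]; simp

theorem beta1_I (hp : 1 < p) (x : MulAut (A true) × MulAut (A false)) (g : G0 p A)
    (h : beta1 p A x = conjA (pr p A) g) : g = 1 ∧ x = 1 := by
  have hg : g = 1 := by
    apply fix_both hp
    intro b
    rw [← conjA_apply (pr p A), ← h, beta1_zg]
  refine ⟨hg, ?_⟩
  rw [hg, map_one] at h
  have key : ∀ b a, fam x b a = a := by
    intro b a
    have h1 : (beta1 p A x).1 (of (M := Hf p A) (i := b) (a, 1)) =
        of (M := Hf p A) (i := b) (a, 1) := by rw [h]; rfl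
    rw [beta1_of] at h1
    exact congrArg Prod.fst (of_injective b h1)
  apply Prod.ext
  · ext a; exact key true a
  · ext a; exact key false a

theorem beta1_straight (hp : 1 < p) (γ : Api (pr p A))
    (h : ∀ b, γ.1 (zg p A b) = zg p A b) : ∃ x, γ = beta1 p A x := by
  obtain ⟨f, hf⟩ := image_equiv hp γ (h true)
  obtain ⟨f', hf'⟩ := image_equiv hp γ (h false)
  refine ⟨(f, f'), Api_ext ?_⟩
  intro b x
  rw [beta1_of]
  cases b
  · exact hf' x
  · exact hf x

theorem beta1_II [∀ b, IsMulTorsionFree (A b)] (hp : 1 < p) (hA : IsEmpty (A true ≃* A false))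
    (α : Api (pr p A)) : ∃ g b, α = conjA (pr p A) g * beta1 p A b := by
  obtain ⟨g, γ, h, h1 | h1⟩ := classify hp α
  · obtain ⟨x, rfl⟩ := beta1_straight hp γ h1
    exact ⟨g, x, h⟩
  · obtain ⟨f, -⟩ := image_equiv hp γ (h1 true)
    exact hA.elim f

end Cls

section Swap
open Monoid Monoid.CoprodI
variable (p : ℕ) (C : Type) [Group C]

/-- the swap of the factors -/
def swapE : G0 p (fun _ => C) →* G0 p (fun _ => C) :=
  lift (fun b => of (M := Hf p (fun _ => C)) (i := !b))

variable {p C}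

theorem swapE_of {b : Bool} (x : C × Zc p) :
    swapE p C (of (M := Hf p (fun _ => C)) (i := b) x) =
      of (M := Hf p (fun _ => C)) (i := !b) x := by
  unfold swapE
  exact lift_of _ _

theorem swapE_swapE (w : G0 p (fun _ => C)) : swapE p C (swapE p C w) = w := by
  have : (swapE p C).comp (swapE p C) = MonoidHom.id _ := by
    apply CoprodI.ext_hom
    intro b
    ext x : 1
    show swapE p C (swapE p C (of (M := Hf p (fun _ => C)) (i := b) x)) = _
    rw [swapE_of, swapE_of]
    cases b <;> rfl
  exact DFunLike.congr_fun this w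

variable (p C)
/-- the swap automorphism -/
def swapA : Api (pr p (fun _ => C)) :=
  ⟨{ toFun := swapE p C
     invFun := swapE p C
     left_inv := swapE_swapE
     right_inv := swapE_swapE
     map_mul' := map_mul _ }, by
    intro g
    have : (pr p (fun _ => C)).comp (swapE p C) = pr p _ := by
      apply CoprodI.ext_hom
      intro b
      ext y : 1
      show pr p (fun _ => C) (swapE p C (of (M := Hf p (fun _ => C)) (i := b) y)) = pr p _ (of _)
      rw [swapE_of, pr_of, pr_of]
    exact DFunLike.congr_fun this g⟩

variable {p C}

theorem swapA_of {b : Bool} (x : C × Zc p) :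
    (swapA p C).1 (of (M := Hf p (fun _ => C)) (i := b) x) =
      of (M := Hf p (fun _ => C)) (i := !b) x := swapE_of x

theorem swapA_sq : swapA p C * swapA p C = 1 := by
  apply Subtype.ext
  ext w
  exact swapE_swapE w

theorem swapA_beta1 (x : MulAut C × MulAut C) :
    swapA p C * beta1 p (fun _ => C) x = beta1 p (fun _ => C) (x.2, x.1) * swapA p C := by
  apply Api_ext
  intro b y
  show (swapA p C).1 ((beta1 p (fun _ => C) x).1 (of y)) =
    (beta1 p (fun _ => C) (x.2, x.1)).1 ((swapA p C).1 (of y))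
  rw [beta1_of, swapA_of, swapA_of, beta1_of]
  cases b <;> rfl

theorem zc2_cases (x : Zc 2) : x = 1 ∨ x = Multiplicative.ofAdd 1 := by
  revert x; decide

theorem z2Hom_gen {N : Type*} [Monoid N] (a : N) (ha : a * a = 1) :
    z2Hom a ha (Multiplicative.ofAdd 1) = a := by
  show a ^ (1 : ZMod 2).val = a
  have : (1 : ZMod 2).val = 1 := rfl
  rw [this, pow_one]

variable (p C)
/-- the semidirect product underlying the wreath product -/
abbrev sd : Type :=
  (MulAut C × MulAut C) ⋊[z2Hom (swapAut (MulAut C)) (swapAut_sq (MulAut C))] Zc 2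

/-- the wreath product as a semidirect product -/
def wrE : wr2 (MulAut C) ≃* sd C where
  toFun w := w
  invFun w := w
  left_inv _ := rfl
  right_inv _ := rfl
  map_mul' _ _ := rfl

/-- the homomorphism from the semidirect product -/
def beta3 : sd C →* Api (pr p (fun _ => C)) :=
  SemidirectProduct.lift (φ := z2Hom (swapAut (MulAut C)) (swapAut_sq (MulAut C)))
    (beta1 p (fun _ => C)) (z2Hom (swapA p C) swapA_sq) (by
    intro y
    ext x : 1
    show beta1 p (fun _ => C) (z2Hom (swapAut (MulAut C)) (swapAut_sq (MulAut C)) y x) =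
      (z2Hom (swapA p C) swapA_sq y) * beta1 p (fun _ => C) x * (z2Hom (swapA p C) swapA_sq y)⁻¹
    rcases zc2_cases y with rfl | rfl
    · rw [map_one, map_one]; simp
    · rw [z2Hom_gen, z2Hom_gen, swapA_beta1, mul_inv_cancel_right]; rfl)

/-- the homomorphism from the wreath product -/
def beta2 : wr2 (MulAut C) →* Api (pr p (fun _ => C)) :=
  (beta3 p C).comp (wrE C).toMonoidHom
variable {p C}

theorem beta3_apply (w : sd C) : beta3 p C w =
    beta1 p (fun _ => C) w.left * z2Hom (swapA p C) swapA_sq w.right := rfl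

theorem beta2_apply (w : wr2 (MulAut C)) : beta2 p C w = beta3 p C (wrE C w) := rfl

theorem swapA_zg (b : Bool) : (swapA p C).1 (zg p (fun _ => C) b) = zg p (fun _ => C) (!b) :=
  swapA_of _

theorem beta2_aux (hp : 1 < p) (x : MulAut C × MulAut C) (y : Zc 2) (g : G0 p (fun _ => C))
    (h : beta1 p (fun _ => C) x * z2Hom (swapA p C) swapA_sq y =
      conjA (pr p (fun _ => C)) g) : g = 1 ∧ x = 1 ∧ y = 1 := by
  rcases zc2_cases y with rfl | rfl
  · rw [map_one, mul_one] at h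
    obtain ⟨h1, h2⟩ := beta1_I (A := fun _ => C) hp x g h
    exact ⟨h1, h2, rfl⟩
  · exfalso
    rw [z2Hom_gen] at h
    have h1 : (conjA (pr p (fun _ => C)) g).1 (zg p _ true) = zg p _ false := by
      rw [← h]
      have h2 : (beta1 p (fun _ => C) x * swapA p C).1 (zg p _ true) =
        (beta1 p (fun _ => C) x).1 ((swapA p C).1 (zg p _ true)) := rfl
      rw [h2, swapA_zg, beta1_zg]; rfl
    have := zg_conj_ne hp g h1
    simp at this

theorem beta2_I (hp : 1 < p) (w : wr2 (MulAut C)) (g : G0 p (fun _ => C))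
    (h : beta2 p C w = conjA (pr p (fun _ => C)) g) : g = 1 ∧ w = 1 := by
  rw [beta2_apply, beta3_apply] at h
  obtain ⟨h1, h2, h3⟩ := beta2_aux hp _ _ g h
  refine ⟨h1, (wrE C).injective ?_⟩
  rw [map_one]
  exact SemidirectProduct.ext h2 h3

theorem beta2_II [IsMulTorsionFree C] (hp : 1 < p) (α : Api (pr p (fun _ => C))) :
    ∃ g b, α = conjA (pr p (fun _ => C)) g * beta2 p C b := by
  obtain ⟨g, γ, h, h1 | h1⟩ := classify hp α
  · obtain ⟨x, rfl⟩ := beta1_straight hp γ h1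
    refine ⟨g, (wrE C).symm ⟨x, 1⟩, ?_⟩
    rw [beta2_apply, MulEquiv.apply_symm_apply, beta3_apply, map_one, mul_one]; exact h
  · obtain ⟨x, hx⟩ := beta1_straight hp (γ * swapA p C) (by
      intro b
      show γ.1 ((swapA p C).1 _) = _
      rw [swapA_zg, h1, Bool.not_not])
    refine ⟨g, (wrE C).symm ⟨x, Multiplicative.ofAdd 1⟩, ?_⟩
    rw [beta2_apply, MulEquiv.apply_symm_apply, beta3_apply, z2Hom_gen, ← hx, mul_assoc,
      swapA_sq, mul_one]; exact h
end Swap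
section Emb
open Monoid Monoid.CoprodI
variable (p : ℕ) (A : Bool → Type) [∀ b, Group (A b)] (S T : Type)
variable {A S T} (eA : FreeGroup S ≃* A true) (eC : FreeGroup T ≃* A false)

/-- the difference of the two embeddings of `Z/p` -/
def ee (A : Bool → Type) [∀ b, Group (A b)] (x : Zc p) : G0 p A :=
  zz p A true x * (zz p A false x)⁻¹

/-- the images of the generators -/
def jgen : S ⊕ (Fin (p - 1) ⊕ T) → G0 p A
  | Sum.inl a => of (M := Hf p A) (i := true) (eA (FreeGroup.of a), 1)
  | Sum.inr (Sum.inl k) => ee p A (Multiplicative.ofAdd (((k : ℕ) + 1 : ℕ) : ZMod p))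
  | Sum.inr (Sum.inr c) => of (M := Hf p A) (i := false) (eC (FreeGroup.of c), 1)

/-- the embedding of the free group -/
def jI : FreeGroup (S ⊕ (Fin (p - 1) ⊕ T)) →* G0 p A := FreeGroup.lift (jgen p eA eC)

variable {p}

theorem jI_of (i : S ⊕ (Fin (p - 1) ⊕ T)) : jI p eA eC (FreeGroup.of i) = jgen p eA eC i := by
  simp [jI]

/-- the words attached to elements of `Z/p` -/
def UU (S T : Type) (x : ZMod p) : FreeGroup (S ⊕ (Fin (p - 1) ⊕ T)) :=
  if h : x.val - 1 < p - 1 ∧ x ≠ 0 then FreeGroup.of (Sum.inr (Sum.inl ⟨x.val - 1, h.1⟩)) else 1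

theorem ee_one : ee p A 1 = 1 := by simp [ee]

theorem UU_zero : UU (p := p) S T 0 = 1 := by simp [UU]

theorem UU_pos (hp : 1 < p) (x : ZMod p) (hx : x ≠ 0) : ∃ k : Fin (p - 1),
    x = (((k : ℕ) + 1 : ℕ) : ZMod p) ∧ UU S T x = FreeGroup.of (Sum.inr (Sum.inl k)) := by
  have : NeZero p := ⟨by omega⟩
  have h1 : x.val ≠ 0 := by rwa [Ne, ZMod.val_eq_zero]
  have h2 := x.val_lt
  refine ⟨⟨x.val - 1, by omega⟩, ?_, ?_⟩
  · have : x.val - 1 + 1 = x.val := by omega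
    simp only [this]
    simp
  · rw [UU, dif_pos ⟨by omega, hx⟩]

theorem UU_succ (hp : 1 < p) (k : Fin (p - 1)) :
    UU S T (((k : ℕ) + 1 : ℕ) : ZMod p) = FreeGroup.of (Sum.inr (Sum.inl k)) := by
  have hk := k.2
  have : (((k : ℕ) + 1 : ℕ) : ZMod p).val = (k : ℕ) + 1 := ZMod.val_cast_of_lt (by omega)
  have h0 : (((k : ℕ) + 1 : ℕ) : ZMod p) ≠ 0 := by
    intro h; rw [h, ZMod.val_zero] at this; omega
  rw [UU, dif_pos ⟨by omega, h0⟩]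
  congr 3
  apply Fin.ext
  show ZMod.val _ - 1 = _
  omega

theorem jI_UU (hp : 1 < p) (x : ZMod p) :
    jI p eA eC (UU S T x) = ee p A (Multiplicative.ofAdd x) := by
  by_cases hx : x = 0
  · subst hx; rw [UU_zero, map_one]; exact ee_one.symm
  · obtain ⟨k, h1, h2⟩ := UU_pos (S := S) (T := T) hp x hx
    rw [h2, jI_of, jgen, ← h1]

theorem ee_mem (hp : 1 < p) (x : Zc p) : ee p A x ∈ (jI p eA eC).range :=
  ⟨UU S T (Multiplicative.toAdd x), jI_UU eA eC hp _⟩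

theorem jI_inl (w : FreeGroup S) : jI p eA eC (FreeGroup.map Sum.inl w) =
    of (M := Hf p A) (i := true) (eA w, 1) := by
  have : (jI p eA eC).comp (FreeGroup.map Sum.inl) =
      ((of (M := Hf p A) (i := true)).comp (MonoidHom.inl (A true) (Zc p))).comp
        eA.toMonoidHom := by
    ext a
    simp [jI_of, jgen]
  exact DFunLike.congr_fun this w

theorem jI_inr (w : FreeGroup T) : jI p eA eC (FreeGroup.map (fun c => Sum.inr (Sum.inr c)) w) =
    of (M := Hf p A) (i := false) (eC w, 1) := by
  have : (jI p eA eC).comp (FreeGroup.map (fun c => Sum.inr (Sum.inr c))) =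
      ((of (M := Hf p A) (i := false)).comp (MonoidHom.inl (A false) (Zc p))).comp
        eC.toMonoidHom := by
    ext a
    simp [jI_of, jgen]
  exact DFunLike.congr_fun this w

theorem a_mem (a : A true) : of (M := Hf p A) (i := true) (a, 1) ∈ (jI p eA eC).range :=
  ⟨FreeGroup.map Sum.inl (eA.symm a), by rw [jI_inl, MulEquiv.apply_symm_apply]⟩

theorem c_mem (a : A false) : of (M := Hf p A) (i := false) (a, 1) ∈ (jI p eA eC).range :=
  ⟨FreeGroup.map (fun c => Sum.inr (Sum.inr c)) (eC.symm a), by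
    rw [jI_inr, MulEquiv.apply_symm_apply]⟩

theorem zz_comm (b : Bool) (a : A b) (x : Zc p) :
    zz p A b x * of (M := Hf p A) (i := b) (a, 1) =
      of (M := Hf p A) (i := b) (a, 1) * zz p A b x := by
  rw [zz_apply, ← map_mul, ← map_mul]; simp

theorem conj_a (a : A true) (x : Zc p) :
    zz p A true x * of (M := Hf p A) (i := true) (a, 1) * (zz p A true x)⁻¹ =
      of (M := Hf p A) (i := true) (a, 1) := by
  rw [zz_comm, mul_inv_cancel_right]

theorem conj_c (a : A false) (x : Zc p) :
    zz p A true x * of (M := Hf p A) (i := false) (a, 1) * (zz p A true x)⁻¹ =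
      ee p A x * of (M := Hf p A) (i := false) (a, 1) * (ee p A x)⁻¹ := by
  have h := zz_comm (p := p) false a x
  have h2 : of (M := Hf p A) (i := false) (a, 1) =
      (zz p A false x)⁻¹ * (of (M := Hf p A) (i := false) (a, 1) * zz p A false x) := by
    rw [← h, inv_mul_cancel_left]
  conv_lhs => rw [h2]
  rw [ee]; group

theorem conj_e (x m : Zc p) :
    zz p A true x * ee p A m * (zz p A true x)⁻¹ = ee p A (x * m) * (ee p A x)⁻¹ := by
  rw [ee, ee, ee, map_mul, map_mul]; group

theorem conj_mem (hp : 1 < p) (x : Zc p) (g : G0 p A) (hg : g ∈ (jI p eA eC).range) :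
    zz p A true x * g * (zz p A true x)⁻¹ ∈ (jI p eA eC).range := by
  obtain ⟨k, rfl⟩ := hg
  have hgen : ∀ i, zz p A true x * jI p eA eC (FreeGroup.of i) * (zz p A true x)⁻¹ ∈
      (jI p eA eC).range := by
    rintro (a | k | c)
    · rw [jI_of, jgen, conj_a]; exact a_mem eA eC _
    · rw [jI_of, jgen, conj_e]
      exact mul_mem (ee_mem eA eC hp _) (inv_mem (ee_mem eA eC hp _))
    · rw [jI_of, jgen, conj_c]
      exact mul_mem (mul_mem (ee_mem eA eC hp _) (c_mem eA eC _)) (inv_mem (ee_mem eA eC hp _))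
  induction k using FreeGroup.induction_on with
  | C1 => simp
  | of i => exact hgen i
  | inv_of i h =>
    have := inv_mem h
    rw [map_inv]
    convert this using 1
    group
  | mul a b ha hb =>
    have := mul_mem ha hb
    rw [map_mul]
    convert this using 1
    group

theorem factor_mem (hp : 1 < p) (g : G0 p A) :
    g * (zz p A true (pr p A g))⁻¹ ∈ (jI p eA eC).range := by
  induction g using CoprodI.induction_on with
  | one => simp
  | of b m =>
    rw [pr_of]
    obtain ⟨a, x⟩ := m
    have h3 : of (M := Hf p A) (i := b) (a, x) =
        of (M := Hf p A) (i := b) (a, 1) * zz p A b x := by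
      rw [zz_apply, ← map_mul]; simp
    rw [h3]
    cases b with
    | true => rw [mul_inv_cancel_right]; exact a_mem eA eC a
    | false =>
      have h4 : of (M := Hf p A) (i := false) (a, 1) * zz p A false x * (zz p A true x)⁻¹ =
        of (M := Hf p A) (i := false) (a, 1) * (ee p A x)⁻¹ := by rw [ee]; group
      rw [h4]
      exact mul_mem (c_mem eA eC a) (inv_mem (ee_mem eA eC hp x))
  | mul a b ha hb =>
    have := mul_mem ha (conj_mem eA eC hp (pr p A a) _ hb)
    rw [map_mul, map_mul]
    convert this using 1
    group

theorem pr_jI (k : FreeGroup (S ⊕ (Fin (p - 1) ⊕ T))) : pr p A (jI p eA eC k) = 1 := by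
  have : (pr p A).comp (jI p eA eC) = 1 := by
    ext i
    obtain a | k | c := i
    · simp [jI_of, jgen, pr_of]
    · simp [jI_of, jgen, ee, pr_zz]
    · simp [jI_of, jgen, pr_of]
  exact DFunLike.congr_fun this k

theorem jI_range (hp : 1 < p) (g : G0 p A) : pr p A g = 1 ↔ ∃ k, jI p eA eC k = g := by
  constructor
  · intro h
    have := factor_mem eA eC hp g
    rw [h, map_one, inv_one, mul_one] at this
    exact this
  · rintro ⟨k, rfl⟩; exact pr_jI eA eC k

theorem jI_cent (hp : 1 < p) (t0 : T) (g : G0 p A)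
    (h : ∀ k, g * jI p eA eC k = jI p eA eC k * g) : g = 1 := by
  set c0 : Hf p A false := (eC (FreeGroup.of t0), 1) with hc0
  have hc : c0 ≠ 1 := by
    intro h1
    have h2 : eC (FreeGroup.of t0) = 1 := congrArg Prod.fst h1
    rw [EmbeddingLike.map_eq_one_iff] at h2
    exact FreeGroup.of_ne_one _ h2
  have hcomm : ∀ n ∈ (jI p eA eC).range, g * n = n * g := by
    rintro _ ⟨k, rfl⟩; exact h k
  set z := zg p A true with hz
  obtain ⟨k, hk⟩ := (malnormal hc g (y := c0)
    (mul_inv_eq_iff_eq_mul.2 (hcomm _ (c_mem eA eC _)))).2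
  have h2 := hcomm _ (conj_mem eA eC hp (Multiplicative.ofAdd 1) _
    (c_mem eA eC (eC (FreeGroup.of t0))))
  change g * (z * of c0 * z⁻¹) = (z * of c0 * z⁻¹) * g at h2
  obtain ⟨m, hm⟩ := (malnormal hc (z⁻¹ * g * z) (y := c0) (by
    have : z⁻¹ * g * z * of c0 * (z⁻¹ * g * z)⁻¹ = z⁻¹ * (g * (z * of c0 * z⁻¹)) * g⁻¹ * z := by
      group
    rw [this, h2]; group)).2
  by_contra hg
  have hk1 : k ≠ 1 := by
    rintro rfl; exact hg (by rw [hk, map_one])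
  obtain ⟨l, hl⟩ := (malnormal hk1 z⁻¹ (y := m) (by rw [← hk, ← hm]; group)).2
  have hz1 : z = 1 := both_of z ⟨_, rfl⟩ ⟨l⁻¹, by rw [map_inv, ← hl, inv_inv]⟩
  have := congrArg (pr p A) hz1
  rw [hz, zg, pr_zz, (pr p A).map_one] at this
  exact gen_ne_one hp this

/-- an action of `H × Z/p` -/
def sig {H K : Type} [Group H] [Group K] (f : H →* K) :
    H × Zc p →* Equiv.Perm (ZMod p × K) :=
  MonoidHom.toHomPerm
    { toFun := fun z w => (w.1 - Multiplicative.toAdd z.2, f z.1 * w.2)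
      map_one' := by
        funext w
        apply Prod.ext
        · show w.1 - 0 = w.1
          simp
        · show f 1 * w.2 = w.2
          simp
      map_mul' := by
        intro a b
        funext w
        apply Prod.ext
        · show w.1 - (Multiplicative.toAdd a.2 + Multiplicative.toAdd b.2) =
            w.1 - Multiplicative.toAdd b.2 - Multiplicative.toAdd a.2
          ring
        · show f (a.1 * b.1) * w.2 = f a.1 * (f b.1 * w.2)
          rw [map_mul, mul_assoc] }

theorem sig_apply {H K : Type} [Group H] [Group K] (f : H →* K) (z : H × Zc p) (w : ZMod p × K) :
    sig f z w = (w.1 - Multiplicative.toAdd z.2, f z.1 * w.2) := rfl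

/-- the twist -/
def Tw {K : Type} [Group K] (u : ZMod p → K) : Equiv.Perm (ZMod p × K) where
  toFun w := (w.1, u w.1 * w.2)
  invFun w := (w.1, (u w.1)⁻¹ * w.2)
  left_inv w := by simp
  right_inv w := by simp

/-- the two actions -/
def tauf : ∀ b, Hf p A b →* Equiv.Perm (ZMod p × FreeGroup (S ⊕ (Fin (p - 1) ⊕ T)))
  | true => sig ((FreeGroup.map Sum.inl).comp eA.symm.toMonoidHom)
  | false => (MulAut.conj (Tw (UU S T))).toMonoidHom.comp
      (sig ((FreeGroup.map (fun c => Sum.inr (Sum.inr c))).comp eC.symm.toMonoidHom))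

theorem tauf_true (z : Hf p A true) (w) : tauf eA eC true z w =
    (w.1 - Multiplicative.toAdd z.2, FreeGroup.map Sum.inl (eA.symm z.1) * w.2) := rfl

theorem tauf_false (z : Hf p A false) (w) : tauf eA eC false z w =
    (w.1 - Multiplicative.toAdd z.2, UU S T (w.1 - Multiplicative.toAdd z.2) *
      (FreeGroup.map (fun c => Sum.inr (Sum.inr c)) (eC.symm z.1) * ((UU S T w.1)⁻¹ * w.2))) := rfl

/-- the action of the free product -/
def tau : G0 p A →* Equiv.Perm (ZMod p × FreeGroup (S ⊕ (Fin (p - 1) ⊕ T))) :=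
  lift (tauf eA eC)

theorem tau_of (b : Bool) (z : Hf p A b) : tau eA eC (of z) = tauf eA eC b z := by
  simp [tau]

theorem tau_gen (hp : 1 < p) (i l) : tau eA eC (jI p eA eC (FreeGroup.of i)) (0, l) =
    (0, FreeGroup.of i * l) := by
  rw [jI_of]
  obtain a | k | c := i
  · rw [jgen, tau_of, tauf_true]; simp
  · rw [jgen, ee, map_mul, ← map_inv, zz_apply, zz_apply, tau_of, tau_of, Equiv.Perm.mul_apply,
      tauf_false, tauf_true]
    simp [-Nat.cast_add, UU_zero, UU_succ hp k]
  · rw [jgen, tau_of, tauf_false]; simp [UU_zero]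

theorem tau_jI (hp : 1 < p) (k l) : tau eA eC (jI p eA eC k) (0, l) = (0, k * l) := by
  induction k using FreeGroup.induction_on generalizing l with
  | C1 => simp
  | of i => exact tau_gen eA eC hp i l
  | inv_of i _ =>
    rw [map_inv, map_inv, Equiv.Perm.inv_eq_iff_eq, tau_gen eA eC hp]
    simp
  | mul a b ha hb =>
    rw [map_mul, map_mul, Equiv.Perm.mul_apply, hb, ha, mul_assoc]

theorem jI_inj (hp : 1 < p) : Function.Injective (jI p eA eC) := by
  intro k l h
  have h1 := tau_jI eA eC hp k 1
  rw [h, tau_jI eA eC hp l 1] at h1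
  have := congrArg Prod.snd h1
  simpa using this.symm

end Emb
section Fin6
open Monoid Monoid.CoprodI
variable {p s : ℕ} {A : Bool → Type} [∀ b, Group (A b)]
variable (eA : FreeGroup (Fin s) ≃* A true) (eC : FreeGroup (Fin (p - 1 - s)) ≃* A false)

/-- the embedding of the free group of rank `2(p-1)` -/
def jF (hs : s ≤ p - 1) (h2 : 2 ≤ p) : FreeGroup (Fin (2 * (p - 1))) →* G0 p A :=
  (jI p eA eC).comp (FreeGroup.freeGroupCongr (eTheta p s hs h2)).symm.toMonoidHom

theorem jF_congr (hs : s ≤ p - 1) (h2 : 2 ≤ p) (w) :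
    jF eA eC hs h2 (FreeGroup.freeGroupCongr (eTheta p s hs h2) w) = jI p eA eC w := by
  show jI p eA eC ((FreeGroup.freeGroupCongr (eTheta p s hs h2)).symm _) = _
  rw [MulEquiv.symm_apply_apply]

theorem jF_of (hs : s ≤ p - 1) (h2 : 2 ≤ p) (i) :
    jF eA eC hs h2 (FreeGroup.of (eTheta p s hs h2 i)) = jI p eA eC (FreeGroup.of i) := by
  rw [← jF_congr eA eC hs h2]; simp

theorem jF_inj (hs : s ≤ p - 1) (h2 : 2 ≤ p) : Function.Injective (jF eA eC hs h2) :=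
  (jI_inj eA eC (by omega)).comp (MulEquiv.injective _)

theorem jF_range (hs : s ≤ p - 1) (h2 : 2 ≤ p) (g : G0 p A) :
    pr p A g = 1 ↔ ∃ k, jF eA eC hs h2 k = g := by
  rw [jI_range eA eC (by omega)]
  constructor
  · rintro ⟨k, rfl⟩; exact ⟨_, jF_congr eA eC hs h2 k⟩
  · rintro ⟨k, rfl⟩; exact ⟨_, rfl⟩

theorem jF_cent (hs : s ≤ p - 1) (h2 : 2 ≤ p) (ht : 0 < p - 1 - s) (g : G0 p A)
    (h : ∀ k, g * jF eA eC hs h2 k = jF eA eC hs h2 k * g) : g = 1 := by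
  apply jI_cent eA eC (by omega) ⟨0, ht⟩
  intro k
  rw [← jF_congr eA eC hs h2]; exact h _

theorem rhs_conj (h2 : 2 ≤ p) (i) :
    jI p eA eC (rhsTheta p s (by omega) i) =
      zg p A true * jI p eA eC (FreeGroup.of i) * (zg p A true)⁻¹ := by
  have hu0 : jI p eA eC (FreeGroup.of (Sum.inr (Sum.inl ⟨0, by omega⟩))) =
      ee p A (Multiplicative.ofAdd 1) := by
    rw [jI_of, jgen]; simp
  obtain a | k | c := i
  · rw [rhsTheta, jI_of, jgen, zg, conj_a]
  · rw [rhsTheta, rotWord, jI_of, jgen, zg, conj_e]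
    split_ifs with h
    · rw [map_mul, map_inv, map_mul, map_inv, FreeGroup.map.of, FreeGroup.map.of, hu0, jI_of, jgen]
      congr 2
      rw [← ofAdd_add]
      congr 1
      push_cast
      ring
    · rw [map_inv, map_inv, FreeGroup.map.of, hu0]
      have h3 : (Multiplicative.ofAdd (1 : ZMod p) *
          Multiplicative.ofAdd (((k : ℕ) + 1 : ℕ) : ZMod p)) = 1 := by
        have hk := k.2
        have h4 : (k : ℕ) + 1 + 1 = p := by omega
        have h5 := congrArg (Nat.cast (R := ZMod p)) h4
        rw [ZMod.natCast_self] at h5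
        rw [← ofAdd_add, ← ofAdd_zero]
        congr 1
        rw [← h5]; push_cast; ring
      rw [h3, ee_one, one_mul]
  · rw [rhsTheta, map_mul, map_mul, map_inv, hu0, jI_of, jgen, zg, conj_c]

theorem formal_eq (hs : s ≤ p - 1) (h2 : 2 ≤ p) :
    formalGen (eTheta p s hs h2) (rhsTheta p s (by omega)) =
      {Out.mk _ (Rhom (jF_inj eA eC hs h2) (jF_range eA eC hs h2)
        (conjA (pr p A) (zz p A true (Multiplicative.ofAdd 1))))} := by
  have key : ∀ k, Rhom (jF_inj eA eC hs h2) (jF_range eA eC hs h2)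
        (conjA (pr p A) (zz p A true (Multiplicative.ofAdd 1)))
        (FreeGroup.of (eTheta p s hs h2 k)) =
        FreeGroup.freeGroupCongr (eTheta p s hs h2) (rhsTheta p s (by omega) k) := by
    intro k
    apply jF_inj eA eC hs h2
    rw [Rhom_spec, conjA_apply, jF_congr, rhs_conj eA eC h2, jF_of]; rfl
  ext x
  constructor
  · rintro ⟨φ, h, rfl⟩
    rw [Set.mem_singleton_iff]
    congr 1
    have : φ.toMonoidHom = (Rhom (jF_inj eA eC hs h2) (jF_range eA eC hs h2)
        (conjA (pr p A) (zz p A true (Multiplicative.ofAdd 1)))).toMonoidHom := by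
      apply FreeGroup.ext_hom
      intro i
      obtain ⟨k, rfl⟩ := (eTheta p s hs h2).surjective i
      exact (h k).trans (key k).symm
    ext w
    exact DFunLike.congr_fun this w
  · intro hx
    rw [Set.mem_singleton_iff] at hx
    exact ⟨_, key, hx⟩

theorem theta_main {B : Type} [Group B] (hs : s ≤ p - 1) (h2 : 2 ≤ p) (ht : 0 < p - 1 - s)
    (eA : FreeGroup (Fin s) ≃* A true) (eC : FreeGroup (Fin (p - 1 - s)) ≃* A false)
    (β : B →* Api (pr p A)) (hI : ∀ b g, β b = conjA (pr p A) g → g = 1 ∧ b = 1)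
    (hII : ∀ α, ∃ g b, α = conjA (pr p A) g * β b) :
    Nonempty ((Subgroup.centralizer ((ETheta p s hs h2 : Subgroup (OutF (2 * (p - 1)))) :
      Set (OutF (2 * (p - 1))))) ≃* Zc p × B) := by
  rw [ETheta, formal_eq eA eC hs h2]
  exact main_abs (jF_inj eA eC hs h2) (jF_range eA eC hs h2) (jF_cent eA eC hs h2 ht)
    (zz p A true) (pr_zz true) (Multiplicative.ofAdd 1)
    (fun x => ⟨(Multiplicative.toAdd x).val, by
      show _ ^ (((Multiplicative.toAdd x).val : ℕ) : ℤ) = x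
      rw [zpow_natCast]; exact (gen_pow (by omega) x).symm⟩) β hI hII

/-- the family of factors in the first case -/
def Afam (s t : ℕ) : Bool → Type
  | true => FreeGroup (Fin s)
  | false => FreeGroup (Fin t)

instance Afam_group (s t : ℕ) : ∀ b, Group (Afam s t b)
  | true => inferInstanceAs (Group (FreeGroup (Fin s)))
  | false => inferInstanceAs (Group (FreeGroup (Fin t)))

instance Afam_tf (s t : ℕ) : ∀ b, IsMulTorsionFree (Afam s t b)
  | true => inferInstanceAs (IsMulTorsionFree (FreeGroup (Fin s)))
  | false => inferInstanceAs (IsMulTorsionFree (FreeGroup (Fin t)))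

theorem free_not_iso {s t : ℕ} (h : s ≠ t) :
    IsEmpty (FreeGroup (Fin s) ≃* FreeGroup (Fin t)) := by
  constructor
  intro e
  have := Fintype.card_congr (Equiv.ofFreeGroupEquiv e)
  simp at this
  exact h this

end Fin6


end OutFormal

namespace OutFormal
open FreeGroup

/-!
STATEMENT 6.  Let `p > 3` be a prime and `n = 2(p-1)`.  For `0 ≤ s < (p-1)/2` the
centralizer of `E_{s,p-1-s}` in `Out(F_n)` is isomorphic to
`Z/p × Aut(F_s) × Aut(F_{p-1-s})`, while for `s = (p-1)/2` the centralizer of `E_{s,s}`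
is isomorphic to `Z/p × (Aut(F_s) ≀ Z/2)`.
-/
theorem statement6 (p : ℕ) (hp : p.Prime) (hp3 : 3 < p) :
    (∀ s (hs : 2 * s < p - 1),
      Nonempty
        ((Subgroup.centralizer
            ((ETheta p s (by omega) (by omega) : Subgroup (OutF (2 * (p - 1)))) :
              Set (OutF (2 * (p - 1))))) ≃*
          Zc p × (AutF s × AutF (p - 1 - s)))) ∧
    (∀ s (hs : 2 * s = p - 1),
      Nonempty
        ((Subgroup.centralizer
            ((ETheta p s (by omega) (by omega) : Subgroup (OutF (2 * (p - 1)))) :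
              Set (OutF (2 * (p - 1))))) ≃*
          Zc p × wr2 (AutF s))) := by
  constructor
  · intro s hs
    exact theta_main (A := Afam s (p - 1 - s)) (B := AutF s × AutF (p - 1 - s)) _ _
      (by omega) (MulEquiv.refl _) (MulEquiv.refl _) (beta1 p (Afam s (p - 1 - s)))
      (beta1_I (p := p) (A := Afam s (p - 1 - s)) (by omega))
      (beta1_II (p := p) (A := Afam s (p - 1 - s)) (by omega) (free_not_iso (s := s) (t := p - 1 - s) (by omega)))
  · intro s hs
    exact theta_main (A := fun _ => FreeGroup (Fin s)) (B := wr2 (AutF s)) _ _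
      (by omega) (MulEquiv.refl _)
      (FreeGroup.freeGroupCongr (finCongr (by omega)))
      (beta2 p (FreeGroup (Fin s))) (beta2_I (p := p) (by omega)) (beta2_II (p := p) (by omega))

end OutFormal
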